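/- arXiv:0808.1947 — 2 statements merged into one kernel-verified Lean document; each statement's English description precedes it below -/
import Mathlib

section
/- For each i with 1 ≤ i ≤ n−1, let M_i be the n×n matrix over U obtained from τ + E[−1] by replacing its i-th column with the column whose entries are all zero except for the entry e_{nn}[0] in row i and the entry e_{ni}[0] in row n. Then cdet M_i − ( |τ + E[−1]|_{nn} − |τ + E[−1]|_{ii} ) lies in the left ideal I of U generated by all e_{kl}[r] with r ≥ 0, where |τ + E[−1]|_{jj} denotes the column-determinant of the (n−1)×(n−1) matrix obtained from τ + E[−1] by deleting row j and column j. -/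
open scoped BigOperators

/-- Generators of the Lie algebra `L`: the elements `e_{ij}[r]`, the central
element `K` and the element `τ`. -/
inductive AffGen (n : ℕ) : Type
  | E : Fin n → Fin n → ℤ → AffGen n
  | K : AffGen n
  | T : AffGen n

/-- The defining relations of the universal enveloping algebra `U(L)`:
`K` is central, `[τ, e_{ij}[r]] = -r e_{ij}[r-1]`, `[τ, K] = 0`, and
`[e_{ij}[r], e_{kl}[s]] = δ_{kj} e_{il}[r+s] - δ_{il} e_{kj}[r+s]
  + r δ_{r,-s} (δ_{kj} δ_{il} - δ_{ij} δ_{kl}/n) K`. -/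
inductive AffRel (n : ℕ) :
    FreeAlgebra ℂ (AffGen n) → FreeAlgebra ℂ (AffGen n) → Prop
  | KE (i j : Fin n) (r : ℤ) :
      AffRel n (FreeAlgebra.ι ℂ (AffGen.K : AffGen n) * FreeAlgebra.ι ℂ (AffGen.E i j r))
            (FreeAlgebra.ι ℂ (AffGen.E i j r) * FreeAlgebra.ι ℂ (AffGen.K : AffGen n))
  | KT :
      AffRel n (FreeAlgebra.ι ℂ (AffGen.K : AffGen n) * FreeAlgebra.ι ℂ (AffGen.T : AffGen n))
            (FreeAlgebra.ι ℂ (AffGen.T : AffGen n) * FreeAlgebra.ι ℂ (AffGen.K : AffGen n))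
  | TE (i j : Fin n) (r : ℤ) :
      AffRel n (FreeAlgebra.ι ℂ (AffGen.T : AffGen n) * FreeAlgebra.ι ℂ (AffGen.E i j r)
              - FreeAlgebra.ι ℂ (AffGen.E i j r) * FreeAlgebra.ι ℂ (AffGen.T : AffGen n))
            ((-r : ℂ) • FreeAlgebra.ι ℂ (AffGen.E i j (r - 1)))
  | EE (i j k l : Fin n) (r s : ℤ) :
      AffRel n (FreeAlgebra.ι ℂ (AffGen.E i j r) * FreeAlgebra.ι ℂ (AffGen.E k l s)
              - FreeAlgebra.ι ℂ (AffGen.E k l s) * FreeAlgebra.ι ℂ (AffGen.E i j r))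
            ((if k = j then FreeAlgebra.ι ℂ (AffGen.E i l (r + s)) else 0)
              - (if i = l then FreeAlgebra.ι ℂ (AffGen.E k j (r + s)) else 0)
              + (((r : ℂ) * (if r = -s then (1 : ℂ) else 0) *
                    ((if k = j then (1 : ℂ) else 0) * (if i = l then (1 : ℂ) else 0)
                      - (if i = j then (1 : ℂ) else 0) * (if k = l then (1 : ℂ) else 0)
                          / (n : ℂ))) •
                  FreeAlgebra.ι ℂ (AffGen.K : AffGen n)))

/-- The universal enveloping algebra `U = U(L)`. -/
abbrev UEA (n : ℕ) : Type := RingQuot (AffRel n)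

/-- The element `e_{ij}[r]` of `U`. -/
noncomputable def eGen (n : ℕ) (i j : Fin n) (r : ℤ) : UEA n :=
  RingQuot.mkAlgHom ℂ (AffRel n) (FreeAlgebra.ι ℂ (AffGen.E i j r))

/-- The central element `K` of `U`. -/
noncomputable def KGen (n : ℕ) : UEA n :=
  RingQuot.mkAlgHom ℂ (AffRel n) (FreeAlgebra.ι ℂ (AffGen.K : AffGen n))

/-- The element `τ` of `U`. -/
noncomputable def tauGen (n : ℕ) : UEA n :=
  RingQuot.mkAlgHom ℂ (AffRel n) (FreeAlgebra.ι ℂ (AffGen.T : AffGen n))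

/-- The column-determinant of a matrix over a (noncommutative) ring:
`cdet A = Σ_σ sgn σ · a_{σ(1)1} a_{σ(2)2} ⋯ a_{σ(n)n}`, factors ordered by
column index. -/
noncomputable def cdet {R : Type*} [Ring R] {n : ℕ} (A : Matrix (Fin n) (Fin n) R) : R :=
  ∑ σ : Equiv.Perm (Fin n),
    (Equiv.Perm.sign σ : ℤ) • (List.ofFn fun j : Fin n => A (σ j) j).prod

/-- The matrix `τ + E[-1]`, with `(i,j)` entry `δ_{ij} τ + e_{ij}[-1]`. -/
noncomputable def tauE (n : ℕ) : Matrix (Fin n) (Fin n) (UEA n) :=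
  Matrix.of fun i j => (if i = j then tauGen n else 0) + eGen n i j (-1)

/-- The subalgebra `U(g₋)` of `U` generated by the `e_{ij}[r]` with `r < 0`. -/
noncomputable def Uneg (n : ℕ) : Subalgebra ℂ (UEA n) :=
  Algebra.adjoin ℂ {x : UEA n | ∃ i j : Fin n, ∃ r : ℤ, r < 0 ∧ x = eGen n i j r}

/-- The left ideal `I` of `U` generated by the `e_{ij}[r]` with `r ≥ 0`. -/
noncomputable def Ipos (n : ℕ) : Submodule (UEA n) (UEA n) :=
  Submodule.span (UEA n)
    {x : UEA n | ∃ i j : Fin n, ∃ r : ℤ, 0 ≤ r ∧ x = eGen n i j r}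

/-- The left submodule `(K + n)·U + I` of `U` (note `K + n` is central,
so `(K+n)·U = U·(K+n)`). -/
noncomputable def KnI (n : ℕ) : Submodule (UEA n) (UEA n) :=
  Submodule.span (UEA n)
    (insert (KGen n + (n : UEA n))
      {x : UEA n | ∃ i j : Fin n, ∃ r : ℤ, 0 ≤ r ∧ x = eGen n i j r})

open Equiv in
/-- The product `∏ A (σ l) l` with the columns `l` taken in the order of the list `w`. -/
def columnProd {R ι : Type*} [Ring R] (A : Matrix ι ι R) (w : List ι) (σ : Perm ι) : R :=
  (w.map fun l => A (σ l) l).prod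

section ColumnProd

open Equiv

variable {R ι : Type*} [Ring R] {A : Matrix ι ι R}

lemma columnProd_append (v w : List ι) (σ : Perm ι) :
    columnProd A (v ++ w) σ = columnProd A v σ * columnProd A w σ := by
  simp [columnProd]

lemma columnProd_cons (l : ι) (w : List ι) (σ : Perm ι) :
    columnProd A (l :: w) σ = A (σ l) l * columnProd A w σ := by
  simp [columnProd]

lemma columnProd_nil (σ : Perm ι) : columnProd A [] σ = 1 := by
  simp [columnProd]

lemma columnProd_congr {w : List ι} {σ ρ : Perm ι} (h : ∀ l ∈ w, σ l = ρ l) :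
    columnProd A w σ = columnProd A w ρ := by
  unfold columnProd
  congr 1
  exact List.map_congr_left fun l hl => by rw [h l hl]

variable [DecidableEq ι]

/-- Moving an element `X` that acts on the entries of `A` like the matrix unit `E_{ab}` past a
product of columns other than `a`. -/
lemma mul_columnProd {X : R} {a b : ι}
    (hX : ∀ k l, X * A k l - A k l * X
      = (if k = b then A a l else 0) - (if l = a then A k b else 0))
    {σ : Perm ι} {v : List ι} (hv : v.Nodup) (ha : a ∉ v) (hσ : ∀ l ∈ v, σ l = a → a = b) :
    X * columnProd A v σ = columnProd A v σ * X
      + if σ⁻¹ b ∈ v then columnProd A v (swap a b * σ) else 0 := by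
  induction v with
  | nil => simp [columnProd]
  | cons c v ih =>
    obtain ⟨hc, hv⟩ := List.nodup_cons.1 hv
    have hca : c ≠ a := fun h => ha (by simp [h])
    have ih := ih hv (fun h => ha (by simp [h])) (fun l hl => hσ l (by simp [hl]))
    have hXc : X * A (σ c) c = A (σ c) c * X + if σ c = b then A a c else 0 := by
      rw [← sub_eq_iff_eq_add', hX, if_neg hca, sub_zero]
    rw [columnProd_cons, ← mul_assoc, hXc, add_mul, mul_assoc, ih, mul_add, ← mul_assoc, add_assoc]
    congr 1
    by_cases hb : σ c = b
    · have hb' : σ⁻¹ b = c := by rw [← hb]; simp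
      have hne : ∀ l ∈ v, σ l ≠ b := fun l hl h => hc (by
        have : l = c := σ.injective (h.trans hb.symm)
        rwa [← this])
      rw [if_pos hb, hb', if_neg hc, if_pos (by simp), mul_zero, zero_add, columnProd_cons]
      have h1 : (swap a b * σ) c = a := by simp [hb]
      rw [h1]
      congr 1
      refine columnProd_congr fun l hl => ?_
      have hla : σ l ≠ a := fun h => hne l hl (h.trans (hσ l (by simp [hl]) h))
      simp [swap_apply_of_ne_of_ne hla (hne l hl)]
    · have hb' : σ⁻¹ b ≠ c := fun h => hb (by rw [← h]; simp)
      have hac : (swap a b * σ) c = σ c := by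
        by_cases h : σ c = a
        · exact absurd (h.trans (hσ c (by simp) h)) hb
        · simp [swap_apply_of_ne_of_ne h hb]
      rw [if_neg hb, zero_mul, add_zero]
      simp only [List.mem_cons, hb', false_or]
      split_ifs
      · rw [columnProd_cons, hac]
      · simp

lemma mul_columnProd_append_singleton {X : R} {a b : ι}
    (hX : ∀ k l, X * A k l - A k l * X
      = (if k = b then A a l else 0) - (if l = a then A k b else 0))
    {σ : Perm ι} {v : List ι} (hv : v.Nodup) (ha : a ∉ v)
    (hσ : ∀ l, (l = a ∨ l ∈ v) → σ l = a → a = b) :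
    X * columnProd A (v ++ [a]) σ = columnProd A (v ++ [a]) σ * X
      + (if σ⁻¹ b ∈ v ++ [a] then columnProd A (v ++ [a]) (swap a b * σ) else 0)
      - columnProd A v σ * A (σ a) b := by
  have hX1 := hX (σ a) a
  rw [if_pos rfl, sub_eq_iff_eq_add] at hX1
  rw [columnProd_append, ← mul_assoc, mul_columnProd hX hv ha (fun l hl => hσ l (Or.inr hl)),
    add_mul]
  simp only [columnProd_append, columnProd_cons, columnProd_nil, mul_one, mul_assoc, hX1]
  have hab : σ⁻¹ b = a ↔ σ a = b := by rw [Perm.inv_eq_iff_eq, eq_comm]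
  have hfix : ∀ l, (l = a ∨ l ∈ v) → σ l ≠ b → (swap a b * σ) l = σ l := fun l hl h => by
    rw [Perm.mul_apply, swap_apply_of_ne_of_ne (fun h' => h (h'.trans (hσ l hl h'))) h]
  by_cases h1 : σ a = b
  · have hc : columnProd A v (swap a b * σ) = columnProd A v σ :=
      columnProd_congr fun l hl => hfix l (Or.inr hl) fun h => ha (by
        rwa [← σ.injective (h.trans h1.symm)])
    have h3 : swap a b (σ a) = a := by simp [h1]
    simp only [List.mem_append, List.mem_singleton, h1, ha, hc, hab.2 h1]
    simp [mul_add, mul_sub, h3]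
    abel
  · have h2 : swap a b (σ a) = σ a := hfix a (Or.inl rfl) h1
    simp only [List.mem_append, List.mem_singleton, hab, h1, Perm.mul_apply, h2]
    split_ifs <;> simp_all [mul_add] <;> abel

/-- If `X` acts on the entries of `A` like `E_{ab}` and `σ c = a` for a column `c` missing from the
product, or `a = b`, then `X` can be moved to the right of the columns `v ++ [a]`. -/
lemma columnProd_mul_mul_columnProd {X : R} {a b : ι}
    (hX : ∀ k l, X * A k l - A k l * X
      = (if k = b then A a l else 0) - (if l = a then A k b else 0))
    {σ : Perm ι} {u v : List ι} (huv : (u ++ (v ++ [a])).Nodup)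
    (hσ : ∀ l ∈ u ++ (v ++ [a]), σ l = a → a = b) :
    columnProd A u σ * (X * columnProd A (v ++ [a]) σ) = columnProd A (u ++ (v ++ [a])) σ * X
      + ((if σ⁻¹ b ∈ v ++ [a] then columnProd A (u ++ (v ++ [a])) (swap a b * σ) else 0)
        - columnProd A (u ++ v) σ * A (σ a) b) := by
  have hnd : v.Nodup ∧ a ∉ v := by
    simp [List.nodup_append] at huv
    grind
  rw [mul_columnProd_append_singleton hX hnd.1 hnd.2 fun l hl => hσ l (by simp; tauto),
    columnProd_append u (v ++ [a]), columnProd_append u (v ++ [a]), columnProd_append u v,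
    mul_sub, mul_add, add_sub_assoc]
  simp only [mul_assoc]
  congr 2
  split_ifs with h
  · congr 1
    refine columnProd_congr fun l hl => ?_
    have hb : σ l ≠ b := fun hb => by
      have : σ⁻¹ b = l := by rw [← hb]; simp
      rw [this] at h
      exact List.disjoint_of_nodup_append huv hl h
    rw [Perm.mul_apply, swap_apply_of_ne_of_ne
      (fun h' => hb (h'.trans (hσ l (by simp [hl]) h'))) hb]
  · simp

variable [Fintype ι]

/-- Neighbouring columns of a Manin matrix may be interchanged in the alternating sum over the
permutations fixing an index. -/
lemma sum_columnProd_swap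
    (hA : ∀ i j k l, A i j * A k l - A k l * A i j = A k j * A i l - A i l * A k j)
    {N p q : ι} {u v : List ι} (hpq : p ≠ q) (hp : p ≠ N) (hq : q ≠ N)
    (hpu : p ∉ u) (hqu : q ∉ u) (hpv : p ∉ v) (hqv : q ∉ v) :
    ∑ σ : Perm ι with σ N = N, (Perm.sign σ : ℤ) • columnProd A (u ++ p :: q :: v) σ
      = ∑ σ : Perm ι with σ N = N, (Perm.sign σ : ℤ) • columnProd A (u ++ q :: p :: v) σ := by
  rw [← sub_eq_zero, ← Finset.sum_sub_distrib]
  refine Finset.sum_involution (fun σ _ => σ * swap p q) ?_ ?_ ?_ ?_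
  · intro σ _
    have hu : columnProd A u (σ * swap p q) = columnProd A u σ :=
      columnProd_congr fun l hl => by
        rw [Perm.mul_apply, swap_apply_of_ne_of_ne (by rintro rfl; contradiction)
          (by rintro rfl; contradiction)]
    have hv : columnProd A v (σ * swap p q) = columnProd A v σ :=
      columnProd_congr fun l hl => by
        rw [Perm.mul_apply, swap_apply_of_ne_of_ne (by rintro rfl; contradiction)
          (by rintro rfl; contradiction)]
    have h := hA (σ p) p (σ q) q
    simp only [columnProd_append, columnProd_cons, hu, hv, Perm.sign_mul, Perm.sign_swap hpq,
      Perm.mul_apply, swap_apply_left, swap_apply_right]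
    have key : ∀ U V : R, (U * (A (σ p) p * (A (σ q) q * V)) - U * (A (σ q) q * (A (σ p) p * V)))
        = (U * (A (σ q) p * (A (σ p) q * V)) - U * (A (σ p) q * (A (σ q) p * V))) := by
      intro U V
      have := congrArg (fun z => U * z * V) h
      simpa only [mul_sub, sub_mul, mul_assoc] using this
    rw [← smul_sub, ← smul_sub, key]
    simp
  · intro σ _ _ h
    exact hpq (swap_eq_one_iff.1 (mul_eq_left.1 h))
  · intro σ hσ
    simpa [swap_apply_of_ne_of_ne hp.symm hq.symm] using hσ
  · intro σ _
    simp [mul_assoc]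

lemma sum_columnProd_move
    (hA : ∀ i j k l, A i j * A k l - A k l * A i j = A k j * A i l - A i l * A k j)
    {N p : ι} (hp : p ≠ N) {u v : List ι} (huv : (u ++ p :: v).Nodup) (hN : N ∉ v) :
    ∑ σ : Perm ι with σ N = N, (Perm.sign σ : ℤ) • columnProd A (u ++ p :: v) σ
      = ∑ σ : Perm ι with σ N = N, (Perm.sign σ : ℤ) • columnProd A (u ++ v ++ [p]) σ := by
  induction v generalizing u with
  | nil => simp
  | cons c v ih =>
    have h : c ∉ u ∧ c ∉ v ∧ p ∉ u ∧ p ∉ v ∧ p ≠ c ∧ c ≠ N := by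
      simp [List.nodup_append] at huv hN
      grind
    obtain ⟨h1, h2, h3, h4, h5, h6⟩ := h
    rw [sum_columnProd_swap hA h5 hp h6 h3 h1 h4 h2]
    have := @ih (u ++ [c]) (by
      refine (List.Perm.nodup_iff ?_).1 huv
      simpa using (List.Perm.append_left u (List.Perm.swap c p v))) (by simp at hN; tauto)
    simpa using this

/-- The terms left over after moving the zero modes to the right add up to the difference of the
two alternating sums. -/
lemma sum_moved_columnProd
    (hA : ∀ i j k l, A i j * A k l - A k l * A i j = A k j * A i l - A i l * A k j)
    {N p : ι} (hp : p ≠ N) {u v : List ι} (huv : (u ++ p :: (v ++ [N])).Nodup) :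
    ∑ σ : Perm ι with σ p = p, (Perm.sign σ : ℤ) •
        ((if σ⁻¹ N ∈ v ++ [N] then columnProd A (u ++ (v ++ [N])) (swap N N * σ) else 0)
          - columnProd A (u ++ v) σ * A (σ N) N)
      + ∑ σ : Perm ι with σ p = N, (Perm.sign σ : ℤ) •
        ((if σ⁻¹ p ∈ v ++ [N] then columnProd A (u ++ (v ++ [N])) (swap N p * σ) else 0)
          - columnProd A (u ++ v) σ * A (σ N) p)
      = ∑ σ : Perm ι with σ N = N, (Perm.sign σ : ℤ) • columnProd A (u ++ p :: v) σ
        - ∑ σ : Perm ι with σ p = p, (Perm.sign σ : ℤ) • columnProd A (u ++ (v ++ [N])) σ := by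
  have hmem : N ∉ u ∧ N ∉ v ∧ p ∉ u ∧ p ∉ v ∧ (u ++ p :: v).Nodup := by
    simp [List.nodup_append] at huv ⊢
    grind
  obtain ⟨hNu, hNv, hpu, hpv, hnd⟩ := hmem
  have hleft : ∑ σ : Perm ι with σ p = N, (Perm.sign σ : ℤ) •
        (if σ⁻¹ p ∈ v ++ [N] then columnProd A (u ++ (v ++ [N])) (swap N p * σ) else 0)
      = -∑ σ : Perm ι with σ p = p, (Perm.sign σ : ℤ) •
        (if σ⁻¹ N ∈ v ++ [N] then columnProd A (u ++ (v ++ [N])) σ else 0) := by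
    rw [← Finset.sum_neg_distrib]
    refine Finset.sum_nbij' (swap N p * ·) (swap N p * ·) ?_ ?_ ?_ ?_ ?_
    · intro σ hσ
      simp_all
    · intro σ hσ
      simp_all
    · intro σ _
      simp
    · intro σ _
      simp
    · intro σ _
      simp only [Perm.sign_mul, Perm.sign_swap hp.symm, mul_inv_rev, Perm.mul_apply, swap_inv,
        swap_apply_left]
      split_ifs <;> simp
  have hright : ∑ σ : Perm ι with σ p = N, (Perm.sign σ : ℤ) • (columnProd A (u ++ v) σ * A (σ N) p)
      = -∑ σ : Perm ι with σ N = N, (Perm.sign σ : ℤ) • columnProd A (u ++ p :: v) σ := by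
    rw [sum_columnProd_move hA hp hnd hNv, ← Finset.sum_neg_distrib]
    refine Finset.sum_nbij' (· * swap N p) (· * swap N p) ?_ ?_ ?_ ?_ ?_
    · intro σ hσ
      simp_all
    · intro σ hσ
      simp_all
    · intro σ _
      simp [mul_assoc]
    · intro σ _
      simp [mul_assoc]
    · intro σ _
      have hc : columnProd A (u ++ v) (σ * swap N p) = columnProd A (u ++ v) σ :=
        columnProd_congr fun l hl => by
          rw [Perm.mul_apply, swap_apply_of_ne_of_ne] <;> rintro rfl <;> simp_all
      rw [columnProd_append (u ++ v) [p], hc]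
      simp [Perm.sign_swap hp.symm, columnProd_cons, columnProd_nil]
  have hmid : ∀ σ : Perm ι, columnProd A (u ++ v) σ * A (σ N) N
      = columnProd A (u ++ (v ++ [N])) σ := fun σ => by
    rw [← List.append_assoc, columnProd_append (u ++ v), columnProd_cons, columnProd_nil, mul_one]
  simp only [smul_sub, Finset.sum_sub_distrib, hleft, hright, hmid, swap_self]
  simp only [← Perm.one_def, one_mul]
  abel

end ColumnProd

section Minor

open Equiv

lemma finRange_map_succAbove {n : ℕ} (j : Fin (n + 1)) {u v : List (Fin (n + 1))}
    (h : List.finRange (n + 1) = u ++ j :: v) :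
    (List.finRange n).map j.succAbove = u ++ v := by
  have hs := List.pairwise_lt_finRange (n + 1)
  have hnd := List.nodup_finRange (n + 1)
  have hmem : ∀ x, x ∈ u ++ j :: v := fun x => h ▸ List.mem_finRange x
  rw [h] at hs hnd
  have hs' : (u ++ v).Pairwise (· < ·) := hs.sublist (by simp)
  have hm : ((List.finRange n).map j.succAbove).Pairwise (· < ·) :=
    List.pairwise_map.2 ((List.pairwise_lt_finRange n).imp fun h => by simpa using h)
  refine List.Perm.eq_of_pairwise (le := (· < ·)) (fun a b _ _ h1 h2 => absurd h1 h2.asymm)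
    hm hs' ?_
  refine (List.perm_ext_iff_of_nodup (hm.imp ne_of_lt) (hs'.imp ne_of_lt)).2 fun x => ?_
  have hx := hmem x
  have : j ∉ u ++ v := by
    simp [List.nodup_append] at hnd ⊢
    grind
  simp only [List.mem_map, List.mem_finRange, true_and, Fin.exists_succAbove_eq_iff]
  simp only [List.mem_append, List.mem_cons] at hx this ⊢
  constructor
  · tauto
  · intro h hxj
    exact this (hxj ▸ h)

lemma cdet_submatrix_succAbove {R : Type*} [Ring R] {n : ℕ}
    (A : Matrix (Fin (n + 1)) (Fin (n + 1)) R) (j : Fin (n + 1)) {u v : List (Fin (n + 1))}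
    (h : List.finRange (n + 1) = u ++ j :: v) :
    cdet (A.submatrix j.succAbove j.succAbove)
      = ∑ σ : Perm (Fin (n + 1)) with σ j = j, (Perm.sign σ : ℤ) • columnProd A (u ++ v) σ := by
  unfold cdet
  have hval : ∀ (σ : Perm (Fin n)) (k : Fin n),
      σ.extendDomain (finSuccAboveEquiv j) (j.succAbove k) = j.succAbove (σ k) :=
    fun σ k => σ.extendDomain_apply_image (finSuccAboveEquiv j) k
  have hj : ∀ σ : Perm (Fin n), σ.extendDomain (finSuccAboveEquiv j) j = j :=
    fun σ => σ.extendDomain_apply_not_subtype _ (by simp)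
  refine Finset.sum_bij (fun σ _ => σ.extendDomain (finSuccAboveEquiv j)) ?_ ?_ ?_ ?_
  · intro σ _
    simp [hj]
  · intro σ _ ρ _ hσρ
    ext k
    have := congrArg (fun f : Perm _ => f (j.succAbove k)) hσρ
    simp only [hval] at this
    rw [Fin.succAbove_right_injective this]
  · intro σ hσ
    have hσ : σ j = j := by simpa using hσ
    have hσ' : ∀ x, x ≠ j ↔ σ x ≠ j := fun x => by
      rw [Ne, Ne, ← hσ, σ.injective.eq_iff, hσ]
    refine ⟨(finSuccAboveEquiv j).symm.permCongr (σ.subtypePerm fun x => (hσ' x).symm),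
      Finset.mem_univ _, ?_⟩
    ext x
    rcases eq_or_ne x j with rfl | hx
    · rw [hj, hσ]
    · obtain ⟨k, rfl⟩ := Fin.exists_succAbove_eq hx
      rw [hval]
      congr 1
      have := congrArg Subtype.val ((finSuccAboveEquiv j).apply_symm_apply
        (σ.subtypePerm (fun x => (hσ' x).symm) (finSuccAboveEquiv j k)))
      exact this
  · intro σ _
    rw [Perm.sign_extendDomain, ← finRange_map_succAbove j h, columnProd, List.map_map,
      List.ofFn_eq_map]
    congr 3
    funext k
    simp [hval]

end Minor

open Equiv in
/-- For a Manin matrix `A` and elements `X b` acting on its entries like the matrix units `E_{Nb}`,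
where `N` is the last index, replacing a column `i ≠ N` of `A` by the column with entries `X N` in
row `i` and `X i` in row `N` yields the difference of two principal minors modulo any left ideal
containing all `X b`. -/
lemma cdet_replace_column_sub_mem {R : Type*} [Ring R] {n : ℕ}
    {A : Matrix (Fin (n + 1)) (Fin (n + 1)) R}
    (hA : ∀ i j k l, A i j * A k l - A k l * A i j = A k j * A i l - A i l * A k j)
    {X : Fin (n + 1) → R}
    (hX : ∀ b k l, X b * A k l - A k l * X b
      = (if k = b then A (Fin.last n) l else 0) - (if l = Fin.last n then A k b else 0))
    {I : Submodule R R} (hI : ∀ b, X b ∈ I) (i : Fin n) :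
    cdet (Matrix.of fun m k : Fin (n + 1) =>
        if k = i.castSucc then
          (if m = i.castSucc then X (Fin.last n)
           else if m = Fin.last n then X i.castSucc else 0)
        else A m k)
      - (cdet (A.submatrix (Fin.last n).succAbove (Fin.last n).succAbove)
         - cdet (A.submatrix i.castSucc.succAbove i.castSucc.succAbove)) ∈ I := by
  obtain ⟨u, w, hw⟩ := List.append_of_mem (List.mem_finRange i)
  have hfin : List.finRange (n + 1) = u.map Fin.castSucc
      ++ i.castSucc :: (w.map Fin.castSucc ++ [Fin.last n]) := by
    rw [List.finRange_succ_last, hw]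
    simp
  generalize u.map Fin.castSucc = u at hfin
  generalize w.map Fin.castSucc = v at hfin
  have hpN : i.castSucc ≠ Fin.last n := Fin.castSucc_ne_last i
  generalize i.castSucc = p at *
  have hfin' : List.finRange (n + 1) = (u ++ p :: v) ++ Fin.last n :: [] := by simp [hfin]
  have hnd := List.nodup_finRange (n + 1)
  rw [hfin] at hnd
  have hmem : p ∉ u ∧ p ∉ v ++ [Fin.last n] ∧ (u ++ (v ++ [Fin.last n])).Nodup := by
    simp [List.nodup_append] at hnd ⊢
    grind
  obtain ⟨hpu, hpv, hnd'⟩ := hmem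
  rw [cdet_submatrix_succAbove _ _ hfin, cdet_submatrix_succAbove _ _ hfin', List.append_nil,
    ← sum_moved_columnProd hA hpN hnd]
  set N := Fin.last n
  have hM : ∀ σ : Perm (Fin (n + 1)), (List.ofFn fun j => (Matrix.of fun m k : Fin (n + 1) =>
        if k = p then
          (if m = p then X N else if m = N then X p else 0)
        else A m k) (σ j) j).prod
      = columnProd A u σ * ((if σ p = p then X N
          else if σ p = N then X p else 0) * columnProd A (v ++ [N]) σ) := by
    intro σ
    rw [List.ofFn_eq_map, hfin, List.map_append, List.map_cons, List.prod_append, List.prod_cons]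
    simp only [Matrix.of_apply, if_true]
    unfold columnProd
    rw [List.map_congr_left (l := u) fun l hl => if_neg (fun h : l = p => hpu (h ▸ hl)),
      List.map_congr_left (l := v ++ [N]) fun l hl => if_neg (fun h : l = p => hpv (h ▸ hl))]
  unfold cdet
  simp only [hM]
  rw [Finset.sum_filter, Finset.sum_filter, ← Finset.sum_add_distrib, ← Finset.sum_sub_distrib]
  refine Submodule.sum_mem _ fun σ _ => ?_
  by_cases h1 : σ p = p
  · have h2 : σ p ≠ N := fun h => hpN (h1.symm.trans h)
    rw [if_pos h1, if_pos h1, if_neg h2, add_zero, ← smul_sub,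
      columnProd_mul_mul_columnProd (hX N) hnd' (fun _ _ _ => rfl),
      add_sub_cancel_right]
    exact zsmul_mem (Submodule.smul_mem _ _ (hI N)) _
  · rw [if_neg h1, if_neg h1, zero_add]
    by_cases h2 : σ p = N
    · rw [if_pos h2, if_pos h2, ← smul_sub,
        columnProd_mul_mul_columnProd (hX p) hnd' ?_,
        add_sub_cancel_right]
      · exact zsmul_mem (Submodule.smul_mem _ _ (hI p)) _
      · intro l hl h
        obtain rfl := σ.injective (h.trans h2.symm)
        simp_all
    · simp [h2]

section AffineRelations

lemma eGen_mul_sub (n : ℕ) (i j k l : Fin n) (r s : ℤ)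
    (h : (r : ℂ) * (if r = -s then 1 else 0) = 0) :
    eGen n i j r * eGen n k l s - eGen n k l s * eGen n i j r
      = (if k = j then eGen n i l (r + s) else 0) - (if i = l then eGen n k j (r + s) else 0) := by
  have hrel := RingQuot.mkAlgHom_rel ℂ (AffRel.EE i j k l r s)
  rw [h, zero_mul, zero_smul, add_zero] at hrel
  simp only [map_sub, map_mul, apply_ite (RingQuot.mkAlgHom ℂ (AffRel n)), map_zero] at hrel
  exact hrel

lemma tauGen_mul_sub (n : ℕ) (i j : Fin n) (r : ℤ) :
    tauGen n * eGen n i j r - eGen n i j r * tauGen n = (-r : ℂ) • eGen n i j (r - 1) := by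
  have hrel := RingQuot.mkAlgHom_rel ℂ (AffRel.TE i j r)
  simp only [map_sub, map_mul, map_smul] at hrel
  exact hrel

/-- `τ + E[-1]` is a Manin matrix. -/
lemma tauE_manin (n : ℕ) (i j k l : Fin n) :
    tauE n i j * tauE n k l - tauE n k l * tauE n i j
      = tauE n k j * tauE n i l - tauE n i l * tauE n k j := by
  have hE : ∀ i j k l : Fin n, eGen n i j (-1) * eGen n k l (-1)
      = eGen n k l (-1) * eGen n i j (-1)
        + ((if k = j then eGen n i l (-2) else 0) - (if i = l then eGen n k j (-2) else 0)) :=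
    fun i j k l => sub_eq_iff_eq_add'.1 (eGen_mul_sub n i j k l (-1) (-1) (by norm_num))
  have hT : ∀ (c : Prop) [Decidable c] (i j : Fin n),
      (if c then tauGen n else 0) * eGen n i j (-1)
        = eGen n i j (-1) * (if c then tauGen n else 0) + if c then eGen n i j (-2) else 0 := by
    intro c _ i j
    have := sub_eq_iff_eq_add'.1 (tauGen_mul_sub n i j (-1))
    split_ifs
    · simpa using this
    · simp
  have hτ : (if i = j then tauGen n else 0) * (if k = l then tauGen n else 0)
      = (if k = l then tauGen n else 0) * (if i = j then tauGen n else 0) := by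
    split_ifs <;> simp
  have hτ' : (if k = j then tauGen n else 0) * (if i = l then tauGen n else 0)
      = (if i = l then tauGen n else 0) * (if k = j then tauGen n else 0) := by
    split_ifs <;> simp
  simp only [tauE, Matrix.of_apply, add_mul, mul_add]
  rw [hE i j k l, hE k j i l, hτ, hτ']
  simp only [hT]
  abel

/-- The zero mode `e_{ab}[0]` acts on the entries of `τ + E[-1]` like the matrix unit `E_{ab}`. -/
lemma eGen_zero_mul_tauE_sub (n : ℕ) (a b k l : Fin n) :
    eGen n a b 0 * tauE n k l - tauE n k l * eGen n a b 0
      = (if k = b then tauE n a l else 0) - (if l = a then tauE n k b else 0) := by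
  have hE := eGen_mul_sub n a b k l 0 (-1) (by simp)
  have hT := tauGen_mul_sub n a b 0
  simp only [Int.cast_zero, neg_zero, zero_smul, sub_eq_zero] at hT
  simp only [zero_add] at hE
  simp only [tauE, Matrix.of_apply, add_mul, mul_add]
  have : ∀ x y z w : UEA n, x + y - (z + w) = (x - z) + (y - w) := fun x y z w => by abel
  rw [this, hE]
  simp only [eq_comm (a := l) (b := a)]
  by_cases h1 : k = l <;> by_cases h2 : k = b <;> by_cases h3 : a = l <;> simp_all

end AffineRelations

/-- key relation.  The matrix size is `n + 1` (the paper's `n`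
is `n + 1 ≥ 2`), and `i : Fin n` runs through the paper's `i = 1, …, n-1` (as
`i.castSucc`); the last row/column index is `Fin.last n`.  Let `M_i` be
obtained from `τ + E[-1]` by replacing column `i` with the column which is zero
except for `e_{nn}[0]` in row `i` and `e_{ni}[0]` in row `n`.  Then
`cdet M_i - (|τ+E[-1]|_{nn} - |τ+E[-1]|_{ii}) ∈ I`, where `|τ+E[-1]|_{jj}`
denotes the column-determinant of the minor with row and column `j` deleted. -/
theorem key_relation (n : ℕ) (hn : 1 ≤ n) (i : Fin n) :
    cdet (Matrix.of fun m k : Fin (n + 1) =>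
        if k = i.castSucc then
          (if m = i.castSucc then eGen (n + 1) (Fin.last n) (Fin.last n) 0
           else if m = Fin.last n then eGen (n + 1) (Fin.last n) i.castSucc 0
           else 0)
        else tauE (n + 1) m k)
      - (cdet ((tauE (n + 1)).submatrix
            (Fin.last n).succAbove (Fin.last n).succAbove)
         - cdet ((tauE (n + 1)).submatrix
            i.castSucc.succAbove i.castSucc.succAbove))
      ∈ Ipos (n + 1) := by
  exact cdet_replace_column_sub_mem (I := Ipos (n + 1)) (tauE_manin (n + 1))
    (fun b => eGen_zero_mul_tauE_sub (n + 1) (Fin.last n) b)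
    (fun b => Submodule.subset_span ⟨Fin.last n, b, 0, le_rfl, rfl⟩) i
end

section
/- For any n×n Manin matrix A = [a_{ij}] with entries in an associative unital algebra over ℂ, the column-determinant can be expanded with rows and columns in reverse order: cdet A = Σ_σ sgn(σ) · a_{σ(n)n} a_{σ(n−1),n−1} ⋯ a_{σ(1)1}, summed over all permutations σ of {1,…,n} (factors ordered by decreasing column index). -/
open scoped BigOperators

/-- A square matrix `A = [a_{ij}]` with entries in a ring is a Manin matrix if
`a_{ij} a_{kl} - a_{kl} a_{ij} = a_{kj} a_{il} - a_{il} a_{kj}` for all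
`i, j, k, l`. -/
def IsManin {R : Type*} [Ring R] {n : ℕ} (A : Matrix (Fin n) (Fin n) R) : Prop :=
  ∀ i j k l : Fin n, A i j * A k l - A k l * A i j = A k j * A i l - A i l * A k j

/-- An ordered product isolates a pair of adjacent factors, with outer factors depending only on
the other entries. -/
theorem exists_prod_ofFn_eq_mul_adjacent {M : Type*} [Monoid M] {n : ℕ} (i : Fin n)
    (f : Fin (n + 1) → M) :
    ∃ u v : M, ∀ g : Fin (n + 1) → M, (∀ j, j ≠ i.castSucc → j ≠ i.succ → g j = f j) →
      (List.ofFn g).prod = u * (g i.castSucc * g i.succ) * v := by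
  induction n with
  | zero => exact i.elim0
  | succ n ih =>
    induction i using Fin.cases with
    | zero =>
      refine ⟨1, (List.ofFn fun j : Fin n => f j.succ.succ).prod, fun g hg => ?_⟩
      have h : (fun j : Fin n => g j.succ.succ) = fun j => f j.succ.succ := by
        funext j
        refine hg _ ?_ ?_ <;> simp [Fin.ext_iff]
      rw [List.ofFn_succ, List.ofFn_succ, h]
      simp [mul_assoc]
    | succ i =>
      obtain ⟨u, v, huv⟩ := ih i fun j => f j.succ
      refine ⟨f 0 * u, v, fun g hg => ?_⟩
      have h0 : g 0 = f 0 := by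
        refine hg _ ?_ ?_ <;> simp [Fin.ext_iff]
      rw [List.ofFn_succ, List.prod_cons, huv (fun j => g j.succ), h0]
      · simp [mul_assoc]
      · intro j h₁ h₂
        refine hg _ ?_ ?_
        · rwa [← Fin.succ_castSucc, Ne, Fin.succ_inj]
        · rwa [Ne, Fin.succ_inj]

/-- Swapping two adjacent columns of a Manin matrix negates the column-determinant. -/
theorem cdet_submatrix_swap_adjacent {R : Type*} [Ring R] {n : ℕ}
    (A : Matrix (Fin (n + 1)) (Fin (n + 1)) R) (hA : IsManin A) (i : Fin n) :
    cdet (A.submatrix id (Equiv.swap i.castSucc i.succ)) = -cdet A := by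
  have hne : i.castSucc ≠ i.succ := (Fin.castSucc_lt_succ).ne
  rw [eq_neg_iff_add_eq_zero, cdet, cdet, ← Finset.sum_add_distrib]
  refine Finset.sum_involution (fun σ _ => σ * Equiv.swap i.castSucc i.succ) ?_ ?_
    (fun _ _ => Finset.mem_univ _) (fun σ _ => by simp [mul_assoc])
  · intro σ _
    obtain ⟨u, v, huv⟩ := exists_prod_ofFn_eq_mul_adjacent i fun j => A (σ j) j
    simp only [Matrix.submatrix_apply, id]
    rw [huv (fun j => A (σ j) j) fun _ _ _ => rfl,
      huv (fun j => A (σ j) (Equiv.swap i.castSucc i.succ j)),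
      huv (fun j => A ((σ * Equiv.swap i.castSucc i.succ) j) j),
      huv (fun j => A ((σ * Equiv.swap i.castSucc i.succ) j) (Equiv.swap i.castSucc i.succ j))]
    · simp only [Equiv.Perm.mul_apply, Equiv.swap_apply_left, Equiv.swap_apply_right,
        Equiv.Perm.sign_mul, Equiv.Perm.sign_swap hne, mul_neg, mul_one, Units.val_neg, neg_smul]
      rw [← smul_add, ← neg_add, ← smul_add, ← sub_eq_add_neg, ← smul_sub]
      simp only [← add_mul, ← mul_add, ← sub_mul, ← mul_sub]
      have h := hA (σ i.castSucc) i.castSucc (σ i.succ) i.succ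
      rw [sub_eq_sub_iff_add_eq_add] at h
      rw [add_comm (A (σ i.castSucc) i.succ * _), h]
      simp [add_comm]
    all_goals
      intro j h₁ h₂
      simp [Equiv.swap_apply_of_ne_of_ne h₁ h₂]
  · intro σ _ _ h
    exact hne (Equiv.swap_eq_one_iff.mp (mul_eq_left.mp h))

theorem IsManin.submatrix {R : Type*} [Ring R] {n : ℕ} {A : Matrix (Fin n) (Fin n) R}
    (hA : IsManin A) (r c : Fin n → Fin n) : IsManin (A.submatrix r c) :=
  fun i j k l => hA (r i) (c j) (r k) (c l)

/-- Permuting the columns of a Manin matrix multiplies the column-determinant by the sign. -/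
theorem cdet_submatrix_perm {R : Type*} [Ring R] {n : ℕ} (A : Matrix (Fin n) (Fin n) R)
    (hA : IsManin A) (τ : Equiv.Perm (Fin n)) :
    cdet (A.submatrix id τ) = (Equiv.Perm.sign τ : ℤ) • cdet A := by
  cases n with
  | zero => simp [Subsingleton.elim τ 1]
  | succ n =>
    have hτ : τ ∈ Submonoid.closure
        (Set.range fun i : Fin n => Equiv.swap i.castSucc i.succ) := by
      rw [Equiv.Perm.mclosure_swap_castSucc_succ]
      trivial
    induction hτ using Submonoid.closure_induction_right with
    | one => simp
    | mul_right τ _ s hs ih =>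
      obtain ⟨i, rfl⟩ := hs
      have h := cdet_submatrix_swap_adjacent (A.submatrix id τ) (hA.submatrix id τ) i
      rw [Matrix.submatrix_submatrix, Function.id_comp, ih] at h
      rw [Equiv.Perm.coe_mul, h, Equiv.Perm.sign_mul,
        Equiv.Perm.sign_swap (Fin.castSucc_lt_succ).ne]
      simp

/-- for a Manin matrix with entries in an associative unital
algebra over ℂ, the column-determinant may be computed with rows and columns in
reverse order:
`cdet A = Σ_σ sgn σ · a_{σ(n)n} a_{σ(n-1),n-1} ⋯ a_{σ(1)1}`. -/
theorem cdet_reverse_manin {R : Type*} [Ring R] [Algebra ℂ R] {n : ℕ}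
    (A : Matrix (Fin n) (Fin n) R) (hA : IsManin A) :
    cdet A = ∑ σ : Equiv.Perm (Fin n),
      (Equiv.Perm.sign σ : ℤ) •
        (List.ofFn fun j : Fin n => A (σ j.rev) j.rev).prod := by
  have h := congrArg (fun x => (Equiv.Perm.sign (Fin.revPerm (n := n)) : ℤ) • x)
    (cdet_submatrix_perm A hA Fin.revPerm)
  simp only [smul_smul, Int.units_coe_mul_self, one_smul] at h
  rw [← h, cdet, Finset.smul_sum]
  refine Fintype.sum_equiv (Equiv.mulRight Fin.revPerm) _ _ fun σ => ?_
  rw [smul_smul]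
  simp [mul_comm (Equiv.Perm.sign Fin.revPerm : ℤ), -zsmul_eq_mul]
end
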